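/- arXiv:1911.01012 — 5 statements merged into one kernel-verified Lean document; each statement's English description precedes it below -/
import Mathlib

section
/- Let γ > 2, ε_f > 0, τ ∈ (0,1) and ν ∈ (0,1) be real numbers with ν/(1−ν) ≥ 2(τ^{-4}−1)/(ε_f(γ−2)). Let a, a', δ, δ' be real numbers with δ > 0, δ' > 0, and suppose that either (i) a' − a ≤ −(γ−2)·ε_f·δ² and δ' ≤ τ^{-2}·δ, or (ii) a' = a and δ' ≤ τ·δ. Then ν·(a' − a) + (1−ν)·(δ'² − δ²) ≤ −(1−ν)(1−τ²)·δ². -/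
theorem stmt_5 (γ εf τ ν : ℝ) (hγ : 2 < γ) (hεf : 0 < εf)
    (hτ : τ ∈ Set.Ioo (0 : ℝ) 1) (hν : ν ∈ Set.Ioo (0 : ℝ) 1)
    (hνchoice : ν / (1 - ν) ≥ 2 * (τ ^ (-4 : ℤ) - 1) / (εf * (γ - 2)))
    (a a' δ δ' : ℝ) (hδ : 0 < δ) (hδ' : 0 < δ')
    (hcase : (a' - a ≤ -((γ - 2) * εf * δ ^ 2) ∧ δ' ≤ τ ^ (-2 : ℤ) * δ) ∨
      (a' = a ∧ δ' ≤ τ * δ)) :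
    ν * (a' - a) + (1 - ν) * (δ' ^ 2 - δ ^ 2) ≤ -((1 - ν) * (1 - τ ^ 2) * δ ^ 2) := by
  obtain ⟨hτ0, hτ1⟩ := hτ
  obtain ⟨hν0, hν1⟩ := hν
  have h1ν : 0 < 1 - ν := by linarith
  rcases hcase with ⟨h1, h2⟩ | ⟨h1, h2⟩
  · have hs4 : τ ^ (-4 : ℤ) = (τ ^ (-2 : ℤ)) ^ 2 := by
      rw [← zpow_natCast, ← zpow_mul]; norm_num
    have hsτ : τ ^ (-2 : ℤ) * τ ^ 2 = 1 := by
      rw [← zpow_natCast τ 2, ← zpow_add₀ hτ0.ne']; norm_num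
    have hs0 : 0 < τ ^ (-2 : ℤ) := zpow_pos hτ0 _
    rw [hs4] at hνchoice
    generalize τ ^ (-2 : ℤ) = s at *
    have ht : τ ^ 2 < 1 := by nlinarith
    have hs1 : 1 ≤ s := by nlinarith
    have hpos : 0 < εf * (γ - 2) := mul_pos hεf (by linarith)
    rw [ge_iff_le, div_le_div_iff₀ hpos h1ν] at hνchoice
    have hd : δ' ^ 2 ≤ s ^ 2 * δ ^ 2 := by
      rw [← mul_pow]; exact pow_le_pow_left₀ hδ'.le h2 2
    have key : 1 - τ ^ 2 ≤ s ^ 2 - 1 := by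
      nlinarith [mul_nonneg (sub_nonneg.2 hs1) (sub_nonneg.2 ht.le)]
    have hδ2 : 0 < δ ^ 2 := by positivity
    have e1 := mul_le_mul_of_nonneg_left h1 hν0.le
    have e2 := mul_le_mul_of_nonneg_left hd h1ν.le
    have e3 := mul_le_mul_of_nonneg_right hνchoice hδ2.le
    have e4 := mul_le_mul_of_nonneg_left key (mul_pos h1ν hδ2).le
    linarith
  · have hd : δ' ^ 2 ≤ τ ^ 2 * δ ^ 2 := by
      rw [← mul_pow]; exact pow_le_pow_left₀ hδ'.le h2 2
    have e2 := mul_le_mul_of_nonneg_left hd h1ν.le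
    subst h1
    linarith
end

section
/- Let γ > 2, ε_f > 0, τ ∈ (0,1) and ν ∈ (0,1) be real numbers with ν/(1−ν) ≥ 2(τ^{-4}−1)/(ε_f(γ−2)). Let a, a', δ, δ', f₀, f_s be real numbers with δ > 0, δ' > 0, and suppose f_s − f₀ ≤ −γ·ε_f·δ² and δ' ≤ τ^{-2}·δ. Then ν·(a' − a) + (1−ν)·(δ'² − δ²) ≤ ν·(|a' − f_s| + |f₀ − a|). -/
theorem stmt_6 (γ εf τ ν : ℝ) (hγ : 2 < γ) (hεf : 0 < εf)
    (hτ : τ ∈ Set.Ioo (0 : ℝ) 1) (hν : ν ∈ Set.Ioo (0 : ℝ) 1)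
    (hνchoice : ν / (1 - ν) ≥ 2 * (τ ^ (-4 : ℤ) - 1) / (εf * (γ - 2)))
    (a a' δ δ' f₀ fs : ℝ) (hδ : 0 < δ) (hδ' : 0 < δ')
    (hdec : fs - f₀ ≤ -(γ * εf * δ ^ 2)) (hstep : δ' ≤ τ ^ (-2 : ℤ) * δ) :
    ν * (a' - a) + (1 - ν) * (δ' ^ 2 - δ ^ 2) ≤ ν * (|a' - fs| + |f₀ - a|) := by
  obtain ⟨h0, h1⟩ := hτ
  obtain ⟨n0, n1⟩ := hν
  have hT : τ ^ (-4 : ℤ) = (τ ^ (-2 : ℤ)) ^ 2 := by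
    rw [← zpow_natCast, ← zpow_mul]; norm_num
  have hT1 : 1 ≤ τ ^ (-2 : ℤ) := one_le_zpow_of_nonpos₀ h0 h1.le (by norm_num)
  rw [hT] at hνchoice
  generalize τ ^ (-2 : ℤ) = T at *
  have hn : 0 < 1 - ν := by linarith
  have hg : 0 < εf * (γ - 2) := mul_pos hεf (by linarith)
  rw [ge_iff_le, div_le_div_iff₀ hg hn] at hνchoice
  have hT2 : 0 ≤ T ^ 2 - 1 := by nlinarith
  have hd : 0 < δ ^ 2 := by positivity
  have e1 : δ' ^ 2 ≤ T ^ 2 * δ ^ 2 := by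
    rw [← mul_pow]; exact pow_le_pow_left₀ hδ'.le hstep 2
  have e2 : (1 - ν) * (δ' ^ 2 - δ ^ 2) ≤ (1 - ν) * ((T ^ 2 - 1) * δ ^ 2) :=
    mul_le_mul_of_nonneg_left (by linarith) hn.le
  have e3 := mul_le_mul_of_nonneg_right hνchoice hd.le
  have e4 : 0 ≤ (1 - ν) * ((T ^ 2 - 1) * δ ^ 2) := by positivity
  have e5 : 0 ≤ ν * εf * δ ^ 2 := by positivity
  have e6 : ν * (a' - a) ≤ ν * (|a' - fs| + |f₀ - a| - γ * εf * δ ^ 2) :=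
    mul_le_mul_of_nonneg_left
      (by linarith [le_abs_self (a' - fs), le_abs_self (f₀ - a)]) n0.le
  linarith
end

section
/- Let (Ω, 𝒢, P) be a probability space with a filtration (𝓕_k)_{k∈ℕ}, let β > 1/2, and for each k ∈ ℕ let J_k ∈ 𝓕_k be an event such that E[𝟙_{J_k} | 𝓕_{k−1}] ≥ β almost surely for all k ≥ 1 and P(J_0) ≥ β. Define the random walk W_k = ∑_{i=0}^{k} (2·𝟙_{J_i} − 1). Then (W_k) is a submartingale with respect to (𝓕_k) and, almost surely, limsup_{k→∞} W_k = +∞. -/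
open MeasureTheory Filter

theorem stmt_11 {Ω : Type*} {m0 : MeasurableSpace Ω}
    (P : Measure Ω) [IsProbabilityMeasure P]
    (ℱ : Filtration ℕ m0) (β : ℝ) (hβ : 1 / 2 < β)
    (J : ℕ → Set Ω) (hJmeas : ∀ k, MeasurableSet[ℱ k] (J k))
    (hJcond : ∀ k : ℕ, ∀ᵐ ω ∂P,
      β ≤ (P[(J (k + 1)).indicator (fun _ => (1 : ℝ)) | ℱ k]) ω)
    (hJ0 : ENNReal.ofReal β ≤ P (J 0))
    (W : ℕ → Ω → ℝ)
    (hW : ∀ k ω, W k ω =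
      ∑ i ∈ Finset.range (k + 1), (2 * (J i).indicator (fun _ => (1 : ℝ)) ω - 1)) :
    Submartingale W ℱ P ∧
      ∀ᵐ ω ∂P, Filter.limsup (fun k => (W k ω : EReal)) atTop = ⊤ := by
  have hWeq : ∀ k, W k = fun ω =>
      ∑ i ∈ Finset.range (k + 1), (2 * (J i).indicator (fun _ => (1 : ℝ)) ω - 1) :=
    fun k => funext (hW k)
  have hind : ∀ k, Integrable ((J k).indicator (fun _ => (1 : ℝ))) P := fun k =>
    (integrable_const (1 : ℝ)).indicator (ℱ.le k _ (hJmeas k))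
  have hstep : ∀ k ω, W (k + 1) ω - W k ω =
      2 * (J (k + 1)).indicator (fun _ => (1 : ℝ)) ω - 1 := by
    intro k ω
    rw [hW, hW, Finset.sum_range_succ _ (k + 1)]
    ring
  have habs : ∀ k ω, |W (k + 1) ω - W k ω| = 1 := by
    intro k ω
    rw [hstep]
    by_cases h : ω ∈ J (k + 1)
    · simp [h]; norm_num
    · simp [h]
  have hsub : Submartingale W ℱ P := by
    apply submartingale_of_condExp_sub_nonneg_nat
    · intro k
      rw [hWeq]
      refine Finset.stronglyMeasurable_fun_sum _ fun i hi => ?_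
      have hi' : i ≤ k := by simpa [Nat.lt_succ_iff] using hi
      have h1 : StronglyMeasurable[ℱ k] ((J i).indicator (fun _ => (1 : ℝ))) :=
        stronglyMeasurable_const.indicator (ℱ.mono hi' _ (hJmeas i))
      exact (stronglyMeasurable_const.mul h1).sub stronglyMeasurable_const
    · intro k
      rw [hWeq]
      exact integrable_finsetSum _ fun i _ => ((hind i).const_mul 2).sub (integrable_const 1)
    · intro k
      have e : W (k + 1) - W k =
          (2 : ℝ) • (J (k + 1)).indicator (fun _ => (1 : ℝ)) - fun _ => (1 : ℝ) := by
        funext ω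
        simpa using hstep k ω
      rw [e]
      have a1 := condExp_sub (m := ℱ k) ((hind (k + 1)).smul (2 : ℝ))
        (integrable_const (μ := P) (1 : ℝ))
      have a2 := condExp_smul (μ := P) (2 : ℝ) ((J (k + 1)).indicator (fun _ => (1 : ℝ))) (ℱ k)
      filter_upwards [a1, a2, hJcond k] with ω h1 h2 h3
      rw [h1, Pi.sub_apply, h2, condExp_const (ℱ.le k)]
      simp only [Pi.zero_apply, Pi.smul_apply, smul_eq_mul]
      linarith
  refine ⟨hsub, ?_⟩
  have hbdd : ∀ᵐ ω ∂P, ∀ i, |W (i + 1) ω - W i ω| ≤ ((1 : NNReal) : ℝ) :=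
    Eventually.of_forall fun ω i => by simp [habs]
  filter_upwards [hsub.bddAbove_iff_exists_tendsto hbdd] with ω hω
  have hnb : ¬ BddAbove (Set.range fun n => W n ω) := by
    intro hb
    obtain ⟨c, hc⟩ := hω.1 hb
    have h2 := (((tendsto_add_atTop_iff_nat 1).2 hc).sub hc).abs
    simp only [habs] at h2
    have := tendsto_nhds_unique h2 tendsto_const_nhds
    simp at this
  rw [EReal.eq_top_iff_forall_lt]
  intro y
  have hfr : ∃ᶠ k in atTop, ((y + 1 : ℝ) : EReal) ≤ (W k ω : EReal) := by
    intro hev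
    apply hnb
    have : IsBoundedUnder (· ≤ ·) atTop fun n => W n ω := by
      refine ⟨y + 1, ?_⟩
      rw [eventually_map]
      filter_upwards [hev] with k hk
      rw [EReal.coe_le_coe_iff] at hk
      exact (not_le.1 hk).le
    exact this.bddAbove_range
  refine lt_of_lt_of_le ?_ (le_limsup_of_frequently_le hfr)
  exact_mod_cast lt_add_one y
end

section
/- Let f : ℝⁿ → ℝ, let x, s ∈ ℝⁿ, let ε > 0, ε_f > 0, γ > 2 and δ > 0 be real numbers with δ ≤ ε/ε_f, and let f₀, f_s be real numbers with |f₀ − f(x)| ≤ ε_f·δ² and |f_s − f(x+s)| ≤ ε_f·δ². If (f(x) − f(x+s))/δ ≥ ε(γ+2), then f_s − f₀ ≤ −γ·ε_f·δ². -/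
theorem stmt_12 {n : ℕ} (f : (Fin n → ℝ) → ℝ) (x s : Fin n → ℝ)
    (ε εf γ δ : ℝ) (hε : 0 < ε) (hεf : 0 < εf) (hγ : 2 < γ) (hδ : 0 < δ)
    (hδsmall : δ ≤ ε / εf)
    (f₀ fs : ℝ)
    (h₀ : |f₀ - f x| ≤ εf * δ ^ 2)
    (hs : |fs - f (x + s)| ≤ εf * δ ^ 2)
    (hdecr : (f x - f (x + s)) / δ ≥ ε * (γ + 2)) :
    fs - f₀ ≤ -(γ * εf * δ ^ 2) := by
  rw [le_div_iff₀ hεf] at hδsmall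
  rw [ge_iff_le, le_div_iff₀ hδ] at hdecr
  have h1 := (abs_le.mp h₀).1
  have h2 := (abs_le.mp hs).2
  have h3 : (δ * εf) * ((γ + 2) * δ) ≤ ε * ((γ + 2) * δ) :=
    mul_le_mul_of_nonneg_right hδsmall (mul_nonneg (by linarith) hδ.le)
  nlinarith [h1, h2, h3, hdecr]
end

section
/- Let n ≥ 1, let h ∈ ℝⁿ with h ≠ 0, and let δ_p ∈ (0,1] be such that 1/δ_p is a positive integer; set δ_m = δ_p². Define d ∈ ℤⁿ coordinatewise by d_i = round((δ_p/δ_m)·h_i/‖h‖_∞), where ‖h‖_∞ = max_i |h_i| and round denotes rounding to the nearest integer. Then δ_p·‖d‖_∞ ≥ 1. -/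
theorem stmt_16 {n : ℕ} (hn : 1 ≤ n) (h : Fin n → ℝ) (hh : h ≠ 0)
    (δp : ℝ) (hδp : δp ∈ Set.Ioc (0 : ℝ) 1)
    (hint : ∃ z : ℕ, 0 < z ∧ 1 / δp = (z : ℝ))
    (δm : ℝ) (hδm : δm = δp ^ 2)
    (d : Fin n → ℤ)
    (hd : ∀ i, d i = round (δp / δm * (h i / ‖h‖))) :
    1 ≤ δp * ‖(fun i => ((d i : ℝ)))‖ := by
  obtain ⟨z, hz, hzd⟩ := hint
  have hp : 0 < δp := hδp.1
  have hq : δp / δm = (z : ℝ) := by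
    rw [← hzd, hδm]; field_simp
  have hpz : δp * (z : ℝ) = 1 := by
    rw [← hzd]; field_simp
  have hpos : 0 < ‖h‖ := norm_pos_iff.mpr hh
  haveI : Nonempty (Fin n) := ⟨⟨0, hn⟩⟩
  obtain ⟨i, hi⟩ := Finite.exists_max (fun i => ‖h i‖)
  have hmax : ‖h‖ = |h i| := by
    apply le_antisymm
    · exact (pi_norm_le_iff_of_nonneg (norm_nonneg _)).mpr hi
    · exact norm_le_pi_norm h i
  have hdi : |(d i : ℝ)| = z := by
    have h1 := hd i
    rw [hq] at h1
    rcases abs_choice (h i) with h2 | h2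
    · have h3 : h i / ‖h‖ = 1 := by
        rw [div_eq_one_iff_eq hpos.ne', hmax, h2]
      rw [h3, mul_one, round_natCast] at h1
      rw [h1]; simp
    · have h3 : h i / ‖h‖ = -1 := by
        rw [div_eq_iff hpos.ne', hmax, h2]; ring
      have h4 : (z : ℝ) * -1 = ((-(z : ℤ) : ℤ) : ℝ) := by push_cast; ring
      rw [h3, h4, round_intCast] at h1
      rw [h1]; simp
  have h5 : (z : ℝ) ≤ ‖(fun i => ((d i : ℝ)))‖ := by
    rw [← hdi]
    exact norm_le_pi_norm (fun i => ((d i : ℝ))) i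
  calc (1 : ℝ) = δp * z := hpz.symm
    _ ≤ _ := mul_le_mul_of_nonneg_left h5 hp.le
end
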